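/- Let φ and Φ be the standard normal density and cumulative distribution function, and let σ_v, σ_u ∈ [σ̲,σ̄] with 0 < σ̲ < σ̄ < ∞. Then the normal–exponential pseudo conditional density f_θ(y|x) = (1/σ_u) Φ(−(y−g(x,β))/σ_v − σ_v/σ_u) exp((y−g(x,β))/σ_u + σ_v²/(2σ_u²)) satisfies, for all x, y, β and all σ_v, σ_u in these ranges: f_θ(y|x) ≤ (1/σ̲) e^{σ̄²/σ̲²} [ sup_{z>0} Φ(−z/σ̄) e^{z/σ̲} + 1 ], and the right-hand side is finite. In particular, the family of densities is uniformly bounded. -/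

import Mathlib

open MeasureTheory Real Set

/-- The standard normal density φ(t) = (2π)^{-1/2} e^{-t²/2}. -/
noncomputable def stdGaussPdf (t : ℝ) : ℝ := (Real.sqrt (2 * Real.pi))⁻¹ * Real.exp (-(t ^ 2) / 2)

/-- The standard normal cumulative distribution function Φ. -/
noncomputable def stdGaussCdf (t : ℝ) : ℝ := ∫ s in Set.Iic t, stdGaussPdf s

/-- The normal–exponential pseudo conditional density
f_θ(y|x) = (1/σ_u) Φ(−(y−g(x,β))/σ_v − σ_v/σ_u) exp((y−g(x,β))/σ_u + σ_v²/(2σ_u²)),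
with θ = (β, σ_v, σ_u). -/
noncomputable def fNE {p q : ℕ} (g : (Fin p → ℝ) → (Fin q → ℝ) → ℝ)
    (θ : (Fin q → ℝ) × ℝ × ℝ) (x : Fin p → ℝ) (y : ℝ) : ℝ :=
  let β := θ.1; let σv := θ.2.1; let σu := θ.2.2
  σu⁻¹ * stdGaussCdf (-((y - g x β) / σv) - σv / σu) *
    Real.exp ((y - g x β) / σu + σv ^ 2 / (2 * σu ^ 2))

open ProbabilityTheory in
lemma stdGaussPdf_eq_gaussianPDFReal : stdGaussPdf = gaussianPDFReal 0 1 := by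
  ext t
  simp [stdGaussPdf, gaussianPDFReal]

open ProbabilityTheory in
lemma integrable_stdGaussPdf : Integrable stdGaussPdf :=
  stdGaussPdf_eq_gaussianPDFReal ▸ integrable_gaussianPDFReal 0 1

lemma stdGaussPdf_nonneg (t : ℝ) : 0 ≤ stdGaussPdf t := by
  unfold stdGaussPdf
  positivity

lemma stdGaussCdf_nonneg (t : ℝ) : 0 ≤ stdGaussCdf t :=
  integral_nonneg stdGaussPdf_nonneg

lemma stdGaussCdf_mono : Monotone stdGaussCdf := fun _ _ h =>
  setIntegral_mono_set integrable_stdGaussPdf.integrableOn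
    (Filter.Eventually.of_forall stdGaussPdf_nonneg) (Iic_subset_Iic.2 h).eventuallyLE

open ProbabilityTheory in
/-- The Chernoff bound for the standard normal distribution. -/
lemma stdGaussCdf_le_exp {c : ℝ} (hc : 0 ≤ c) (x : ℝ) :
    stdGaussCdf x ≤ Real.exp (c * x + c ^ 2 / 2) := by
  have hint : Integrable (fun s => Real.exp (c * x + c ^ 2 / 2) * gaussianPDFReal (-c) 1 s) :=
    (integrable_gaussianPDFReal (-c) 1).const_mul _
  calc stdGaussCdf x
      ≤ ∫ s in Iic x, Real.exp (c * x + c ^ 2 / 2) * gaussianPDFReal (-c) 1 s := by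
        refine setIntegral_mono_on integrable_stdGaussPdf.integrableOn hint.integrableOn
          measurableSet_Iic fun s hs => ?_
        have hs : s ≤ x := hs
        simp only [stdGaussPdf, gaussianPDFReal, NNReal.coe_one, mul_one]
        rw [mul_left_comm, ← Real.exp_add]
        gcongr
        nlinarith [mul_le_mul_of_nonneg_left hs hc]
    _ ≤ ∫ s, Real.exp (c * x + c ^ 2 / 2) * gaussianPDFReal (-c) 1 s :=
        setIntegral_le_integral hint (Filter.Eventually.of_forall fun s =>
          mul_nonneg (Real.exp_pos _).le (gaussianPDFReal_nonneg _ _ _))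
    _ = Real.exp (c * x + c ^ 2 / 2) := by
        rw [integral_const_mul, integral_gaussianPDFReal_eq_one _ one_ne_zero, mul_one]

lemma stdGaussCdf_le_one (x : ℝ) : stdGaussCdf x ≤ 1 := by
  simpa using stdGaussCdf_le_exp le_rfl x

lemma stdGaussCdf_mul_exp_le {a b : ℝ} (ha : 0 < a) (hb : 0 < b) (z : ℝ) :
    stdGaussCdf (-(z / b)) * Real.exp (z / a) ≤ Real.exp ((b / a) ^ 2 / 2) := by
  calc stdGaussCdf (-(z / b)) * Real.exp (z / a)
      ≤ Real.exp (b / a * -(z / b) + (b / a) ^ 2 / 2) * Real.exp (z / a) := by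
        gcongr
        exact stdGaussCdf_le_exp (by positivity) _
    _ = Real.exp ((b / a) ^ 2 / 2) := by
        rw [← Real.exp_add]
        congr 1
        field_simp
        ring

lemma le_biSup_of_nonneg {ι : Type*} {s : Set ι} {f : ι → ℝ} {C : ℝ}
    (hf : ∀ i, 0 ≤ f i) (hC : ∀ i, f i ≤ C) {i : ι} (hi : i ∈ s) :
    f i ≤ ⨆ j ∈ s, f j := by
  have hbdd : BddAbove (range fun j => ⨆ _ : j ∈ s, f j) := by
    refine ⟨C, ?_⟩
    rintro _ ⟨j, rfl⟩
    exact Real.iSup_le (fun _ => hC j) ((hf j).trans (hC j))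
  refine le_ciSup_of_le hbdd i ?_
  simp [hi]

/-- on the parameter ranges σ_v, σ_u ∈ [σ̲,σ̄] with 0 < σ̲ ≤ σ̄ < ∞, the
normal–exponential pseudo conditional density satisfies
f_θ(y|x) ≤ (1/σ̲) e^{σ̄²/σ̲²} [ sup_{z>0} Φ(−z/σ̄) e^{z/σ̲} + 1 ], and this right-hand side
is finite (the supremum is that of a bounded function); in particular the family of
densities is uniformly bounded. -/
theorem fNE_uniformly_bounded {p q : ℕ} (g : (Fin p → ℝ) → (Fin q → ℝ) → ℝ)
    (sl su : ℝ) (hsl : 0 < sl) (hs : sl ≤ su) :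
    (∀ (β : Fin q → ℝ) (σv σu : ℝ),
      σv ∈ Set.Icc sl su → σu ∈ Set.Icc sl su →
      ∀ (x : Fin p → ℝ) (y : ℝ),
        fNE g (β, σv, σu) x y
          ≤ sl⁻¹ * Real.exp (su ^ 2 / sl ^ 2) *
              ((⨆ z ∈ Set.Ioi (0 : ℝ), stdGaussCdf (-(z / su)) * Real.exp (z / sl)) + 1))
    ∧ BddAbove ((fun z => stdGaussCdf (-(z / su)) * Real.exp (z / sl)) '' Set.Ioi (0 : ℝ)) := by
  have hsu : 0 < su := hsl.trans_le hs
  have hbound := stdGaussCdf_mul_exp_le hsl hsu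
  refine ⟨?_, Real.exp ((su / sl) ^ 2 / 2), ?_⟩
  · rintro β σv σu ⟨hv, hv'⟩ ⟨hu, hu'⟩ x y
    have hv0 : 0 < σv := hsl.trans_le hv
    have hu0 : 0 < σu := hsl.trans_le hu
    have hnn (z : ℝ) : 0 ≤ stdGaussCdf (-(z / su)) * Real.exp (z / sl) :=
      mul_nonneg (stdGaussCdf_nonneg _) (Real.exp_pos _).le
    simp only [fNE]
    generalize y - g x β = t
    set S := ⨆ z ∈ Ioi (0 : ℝ), stdGaussCdf (-(z / su)) * Real.exp (z / sl)
    have hS0 : 0 ≤ S := Real.iSup_nonneg fun z => Real.iSup_nonneg fun _ => hnn z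
    have hexp : Real.exp (σv ^ 2 / (2 * σu ^ 2)) ≤ Real.exp (su ^ 2 / sl ^ 2) := by
      gcongr
      nlinarith [pow_le_pow_left₀ hsl.le hu 2, sq_nonneg σu]
    have hmain : stdGaussCdf (-(t / σv) - σv / σu) * Real.exp (t / σu) ≤ S + 1 := by
      rcases le_or_gt t 0 with ht | ht
      · have h1 : Real.exp (t / σu) ≤ 1 :=
          Real.exp_le_one_iff.2 (div_nonpos_of_nonpos_of_nonneg ht hu0.le)
        have := mul_le_one₀ (stdGaussCdf_le_one (-(t / σv) - σv / σu)) (Real.exp_pos _).le h1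
        linarith
      · have hcdf : stdGaussCdf (-(t / σv) - σv / σu) ≤ stdGaussCdf (-(t / su)) := by
          apply stdGaussCdf_mono
          have h1 : t / su ≤ t / σv := by gcongr
          have h2 : 0 < σv / σu := by positivity
          linarith
        have h1 : Real.exp (t / σu) ≤ Real.exp (t / sl) := by gcongr
        have h2 := mul_le_mul hcdf h1 (Real.exp_pos _).le (stdGaussCdf_nonneg _)
        have h3 := le_biSup_of_nonneg hnn hbound (mem_Ioi.2 ht)
        linarith
    calc σu⁻¹ * stdGaussCdf (-(t / σv) - σv / σu) * Real.exp (t / σu + σv ^ 2 / (2 * σu ^ 2))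
        = σu⁻¹ * Real.exp (σv ^ 2 / (2 * σu ^ 2)) *
            (stdGaussCdf (-(t / σv) - σv / σu) * Real.exp (t / σu)) := by
          rw [Real.exp_add]
          ring
      _ ≤ sl⁻¹ * Real.exp (su ^ 2 / sl ^ 2) * (S + 1) := by
          have := stdGaussCdf_nonneg (-(t / σv) - σv / σu)
          gcongr
  · rintro _ ⟨z, -, rfl⟩
    exact hbound z
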